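/- Let Z be a standard p-dimensional normal vector, and for a bounded function h : ℝ^p → ℝ having bounded mixed partial derivatives up to order 3 set Φh = E[h(Z)] and, for u ≥ 0, (T_u h)(w) = E[h(w e^{−u} + √(1−e^{−2u}) Z)]. Then the function g(w) = −∫₀^∞ [(T_u h)(w) − Φh] du is well defined and solves the partial differential equation tr(D²g(w)) − w·∇g(w) = h(w) − Φh for all w ∈ ℝ^p, where D²g is the Hessian of g and ∇g its gradient. -/

import Mathlib

open MeasureTheory ProbabilityTheory Real

/-- The standard `p`-dimensional Gaussian measure. -/
noncomputable def stdGaussianPi (p : ℕ) : Measure (Fin p → ℝ) :=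
  Measure.pi fun _ => gaussianReal 0 1

/-- The Ornstein–Uhlenbeck semigroup:
`(T_u h)(w) = E[h(w e^{-u} + √(1 - e^{-2u}) Z)]`, `Z` standard normal in `ℝᵖ`. -/
noncomputable def ouSemigroup {p : ℕ} (u : ℝ) (h : (Fin p → ℝ) → ℝ)
    (w : Fin p → ℝ) : ℝ :=
  ∫ z, h (fun i => w i * Real.exp (-u) + Real.sqrt (1 - Real.exp (-2 * u)) * z i)
    ∂(stdGaussianPi p)

/-- The `k`-th order mixed partial derivative of `g : ℝᵖ → ℝ`. -/
noncomputable def mixedPartial {p : ℕ} (k : ℕ) (g : (Fin p → ℝ) → ℝ)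
    (idx : Fin k → Fin p) (w : Fin p → ℝ) : ℝ :=
  iteratedFDeriv ℝ k g w fun l => Pi.single (idx l) 1

open scoped Topology
open Filter

instance isProbabilityMeasure_stdGaussianPi (p : ℕ) : IsProbabilityMeasure (stdGaussianPi p) := by
  unfold stdGaussianPi
  infer_instance

lemma integrable_gaussianReal_iff {f : ℝ → ℝ} :
    Integrable f (gaussianReal 0 1) ↔ Integrable fun x => gaussianPDFReal 0 1 x * f x := by
  rw [gaussianReal_of_var_ne_zero _ one_ne_zero,
    integrable_withDensity_iff_integrable_smul' (measurable_gaussianPDF _ _)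
      (Eventually.of_forall fun _ => gaussianPDF_lt_top)]
  simp [toReal_gaussianPDF]

lemma hasDerivAt_gaussianPDFReal (x : ℝ) :
    HasDerivAt (gaussianPDFReal 0 1) (-(x * gaussianPDFReal 0 1 x)) x := by
  have h : HasDerivAt (fun y : ℝ => -(y - 0) ^ 2 / (2 * ((1 : NNReal) : ℝ))) (-x) x := by
    have h0 : HasDerivAt (fun y : ℝ => -y ^ 2 / 2) (-(2 * x) / 2) x := by
      simpa using (hasDerivAt_pow 2 x).fun_neg.div_const 2
    convert h0 using 1
    · ext y
      simp
    · ring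
  have := h.exp.const_mul (√(2 * π * ((1 : NNReal) : ℝ)))⁻¹
  refine this.congr_deriv ?_
  simp only [gaussianPDFReal]
  ring

lemma integrable_id_gaussianReal : Integrable (fun x : ℝ => x) (gaussianReal 0 1) :=
  (memLp_id_gaussianReal 1).integrable le_rfl

/-- Gaussian integration by parts on the real line. -/
lemma integral_id_mul_gaussianReal {f f' : ℝ → ℝ} {C C' : ℝ}
    (hf : ∀ x, HasDerivAt f (f' x) x) (hf' : Continuous f')
    (hC : ∀ x, ‖f x‖ ≤ C) (hC' : ∀ x, ‖f' x‖ ≤ C') :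
    ∫ x, x * f x ∂gaussianReal 0 1 = ∫ x, f' x ∂gaussianReal 0 1 := by
  have hfc : Continuous f := continuous_iff_continuousAt.2 fun x => (hf x).continuousAt
  have h1 : Integrable (fun x => f x * x) (gaussianReal 0 1) :=
    integrable_id_gaussianReal.bdd_mul hfc.aestronglyMeasurable (Eventually.of_forall hC)
  have h2 : Integrable f' (gaussianReal 0 1) :=
    .of_bound hf'.aestronglyMeasurable C' (Eventually.of_forall hC')
  have h3 : Integrable f (gaussianReal 0 1) :=
    .of_bound hfc.aestronglyMeasurable C (Eventually.of_forall hC)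
  rw [integrable_gaussianReal_iff] at h1 h2 h3
  have key := integral_mul_deriv_eq_deriv_mul_of_integrable
    (fun x _ => hf x) (fun x _ => hasDerivAt_gaussianPDFReal x)
    (h1.neg.congr (Eventually.of_forall fun x => by simp; ring))
    (h2.congr (Eventually.of_forall fun x => by simp; ring))
    (h3.congr (Eventually.of_forall fun x => by simp; ring))
  rw [integral_gaussianReal_eq_integral_smul one_ne_zero,
    integral_gaussianReal_eq_integral_smul one_ne_zero]
  simp only [mul_neg, integral_neg, neg_inj] at key
  simp only [smul_eq_mul]
  calc _ = ∫ x, f x * (x * gaussianPDFReal 0 1 x) := by congr! 2; ring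
    _ = _ := key
    _ = _ := by congr! 2; ring

lemma integrable_norm_stdGaussianPi (p : ℕ) :
    Integrable (fun z : Fin p → ℝ => ‖z‖) (stdGaussianPi p) := by
  have h : Integrable (fun z : Fin p → ℝ => ∑ i, ‖z i‖) (stdGaussianPi p) :=
    integrable_finsetSum _ fun i _ =>
      (integrable_comp_eval (μ := fun _ : Fin p => gaussianReal 0 1) (i := i)
        integrable_id_gaussianReal).norm
  refine h.mono' continuous_norm.aestronglyMeasurable (Eventually.of_forall fun z => ?_)
  rw [norm_norm]
  exact (pi_norm_le_iff_of_nonneg (Finset.sum_nonneg fun i _ => norm_nonneg _)).2 fun i =>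
    Finset.single_le_sum (f := fun i => ‖z i‖) (fun i _ => norm_nonneg _) (Finset.mem_univ i)

/-- Gaussian integration by parts in the `i`-th coordinate. -/
lemma integral_eval_mul_stdGaussianPi {p : ℕ} {f : (Fin p → ℝ) → ℝ} {C C' : ℝ}
    (hf : ContDiff ℝ 1 f) (hC : ∀ x, ‖f x‖ ≤ C) (hC' : ∀ x, ‖fderiv ℝ f x‖ ≤ C') (i : Fin p) :
    ∫ z, z i * f z ∂stdGaussianPi p
      = ∫ z, fderiv ℝ f z (Pi.single i 1) ∂stdGaussianPi p := by
  have hfc := hf.continuous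
  have hdc : Continuous fun z => fderiv ℝ f z (Pi.single i 1) :=
    (hf.continuous_fderiv one_ne_zero).clm_apply continuous_const
  have hdb : ∀ z, ‖fderiv ℝ f z (Pi.single i 1)‖ ≤ C' := fun z =>
    ((fderiv ℝ f z).le_opNorm _).trans (by simpa [Pi.norm_single] using hC' z)
  have h1 : Integrable (fun z : Fin p → ℝ => z i * f z) (stdGaussianPi p) :=
    (integrable_comp_eval (μ := fun _ : Fin p => gaussianReal 0 1) (i := i)
      integrable_id_gaussianReal).mul_bdd hfc.aestronglyMeasurable (Eventually.of_forall hC)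
  have h2 : Integrable (fun z => fderiv ℝ f z (Pi.single i 1)) (stdGaussianPi p) :=
    .of_bound hdc.aestronglyMeasurable C' (Eventually.of_forall hdb)
  obtain _ | n := p
  · exact i.elim0
  have mp := (measurePreserving_piFinSuccAbove (fun _ : Fin (n + 1) => gaussianReal 0 1) i).symm
  have emb := (MeasurableEquiv.piFinSuccAbove (fun _ : Fin (n + 1) => ℝ) i).symm.measurableEmbedding
  unfold stdGaussianPi at *
  rw [← mp.integrable_comp_emb emb] at h1 h2
  rw [← mp.integral_comp emb, ← mp.integral_comp emb]
  refine (integral_prod_symm _ h1).trans (Eq.trans ?_ (integral_prod_symm _ h2).symm)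
  refine integral_congr_ae (Eventually.of_forall fun y => ?_)
  have hins : ∀ x : ℝ, (MeasurableEquiv.piFinSuccAbove (fun _ : Fin (n + 1) => ℝ) i).symm (x, y)
      = i.insertNth x y := fun x => rfl
  have hd : ∀ x : ℝ, HasDerivAt (fun x : ℝ => (i.insertNth x y : Fin (n + 1) → ℝ))
      (Pi.single i 1) x := fun x => by
    rw [hasDerivAt_pi]
    intro j
    refine i.succAboveCases ?_ (fun k => ?_) j
    · simpa using hasDerivAt_id' x
    · simpa using hasDerivAt_const x (y k)
  have hic : Continuous fun x : ℝ => (i.insertNth x y : Fin (n + 1) → ℝ) :=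
    continuous_iff_continuousAt.2 fun x => (hd x).continuousAt
  simp only [Function.comp_apply, hins, Fin.insertNth_apply_same]
  exact integral_id_mul_gaussianReal (f := fun x => f (i.insertNth x y))
    (fun x => ((hf.differentiable one_ne_zero _).hasFDerivAt.comp_hasDerivAt x (hd x)))
    (hdc.comp hic) (fun x => hC _) (fun x => hdb _)

section OrnsteinUhlenbeck

variable {p : ℕ} {G : Type*} [NormedAddCommGroup G]

/-- The point `e^{-u} w + √(1 - e^{-2u}) z`. -/
noncomputable def ouPoint (u : ℝ) (w z : Fin p → ℝ) : Fin p → ℝ :=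
  exp (-u) • w + √(1 - exp (-2 * u)) • z

lemma continuous_ouPoint_right (u : ℝ) (w : Fin p → ℝ) : Continuous (ouPoint u w) := by
  unfold ouPoint
  fun_prop

lemma continuous_ouPoint_left (w z : Fin p → ℝ) : Continuous fun u => ouPoint u w z := by
  unfold ouPoint
  fun_prop

lemma hasFDerivAt_ouPoint (u : ℝ) (w z : Fin p → ℝ) :
    HasFDerivAt (fun w => ouPoint u w z)
      (exp (-u) • ContinuousLinearMap.id ℝ (Fin p → ℝ)) w :=
  ((hasFDerivAt_id w).const_smul (exp (-u))).add_const _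

lemma integrable_comp_ouPoint {φ : (Fin p → ℝ) → G} {C : ℝ} (hφ : Continuous φ)
    (hC : ∀ x, ‖φ x‖ ≤ C) (u : ℝ) (w : Fin p → ℝ) :
    Integrable (fun z => φ (ouPoint u w z)) (stdGaussianPi p) :=
  .of_bound (hφ.comp (continuous_ouPoint_right u w)).aestronglyMeasurable C
    (Eventually.of_forall fun _ => hC _)

variable [NormedSpace ℝ G]

lemma clm_apply_eq_sum (L : (Fin p → ℝ) →L[ℝ] G) (v : Fin p → ℝ) :
    L v = ∑ i, v i • L (Pi.single i 1) := by
  conv_lhs => rw [pi_eq_sum_univ' v]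
  simp [map_sum, Pi.single]

lemma opNorm_le_of_norm_single_le {L : (Fin p → ℝ) →L[ℝ] G} {C : ℝ}
    (hC : ∀ i, ‖L (Pi.single i 1)‖ ≤ C) : ‖L‖ ≤ p * |C| := by
  refine L.opNorm_le_bound (by positivity) fun v => ?_
  rw [clm_apply_eq_sum]
  refine (norm_sum_le _ _).trans ((Finset.sum_le_sum fun i _ => ?_).trans_eq
    (b := ∑ _i : Fin p, ‖v‖ * |C|) (by simp; ring))
  rw [norm_smul]
  exact mul_le_mul (norm_le_pi_norm v i) ((hC i).trans (le_abs_self C)) (norm_nonneg _)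
    (norm_nonneg _)

/-- The Ornstein–Uhlenbeck semigroup acting on vector-valued functions. -/
noncomputable def ouMean (φ : (Fin p → ℝ) → G) (u : ℝ) (w : Fin p → ℝ) : G :=
  ∫ z, φ (ouPoint u w z) ∂stdGaussianPi p

lemma ouSemigroup_eq_ouMean (u : ℝ) (h : (Fin p → ℝ) → ℝ) (w : Fin p → ℝ) :
    ouSemigroup u h w = ouMean h u w := by
  unfold ouSemigroup ouMean
  congr! 3 with z
  ext i
  simp [ouPoint, mul_comm]

lemma norm_ouMean_le {φ : (Fin p → ℝ) → G} {C : ℝ} (hC : ∀ x, ‖φ x‖ ≤ C) (u : ℝ)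
    (w : Fin p → ℝ) : ‖ouMean φ u w‖ ≤ C := by
  simpa [ouMean] using norm_integral_le_of_norm_le_const (μ := stdGaussianPi p)
    (Eventually.of_forall fun z => hC (ouPoint u w z))

lemma continuous_ouMean {φ : (Fin p → ℝ) → G} {C : ℝ} (hφ : Continuous φ)
    (hC : ∀ x, ‖φ x‖ ≤ C) (w : Fin p → ℝ) : Continuous fun u => ouMean φ u w :=
  continuous_of_dominated
    (fun u => (integrable_comp_ouPoint hφ hC u w).aestronglyMeasurable)
    (fun _ => Eventually.of_forall fun _ => hC _) (integrable_const C)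
    (Eventually.of_forall fun z => hφ.comp (continuous_ouPoint_left w z))

lemma hasFDerivAt_ouMean {φ : (Fin p → ℝ) → G} {B C : ℝ} (hφ : ContDiff ℝ 1 φ)
    (hB : ∀ x, ‖φ x‖ ≤ B) (hC : ∀ x, ‖fderiv ℝ φ x‖ ≤ C) (u : ℝ) (w : Fin p → ℝ) :
    HasFDerivAt (ouMean φ u) (exp (-u) • ouMean (fderiv ℝ φ) u w) w := by
  have hφ' := hφ.continuous_fderiv one_ne_zero
  have hint := integrable_comp_ouPoint hφ' hC u w
  unfold ouMean
  rw [← integral_smul]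
  refine hasFDerivAt_integral_of_dominated_of_fderiv_le
    (F' := fun w z => exp (-u) • fderiv ℝ φ (ouPoint u w z)) (bound := fun _ => exp (-u) * C)
    univ_mem
    (Eventually.of_forall fun w =>
      (integrable_comp_ouPoint hφ.continuous hB u w).aestronglyMeasurable)
    (integrable_comp_ouPoint hφ.continuous hB u w) (hint.smul (exp (-u))).aestronglyMeasurable
    (Eventually.of_forall fun z x _ => ?_) (integrable_const _)
    (Eventually.of_forall fun z x _ => ?_)
  · rw [norm_smul, norm_of_nonneg (exp_pos _).le]
    gcongr
    exact hC _
  · refine ((hφ.differentiable one_ne_zero _).hasFDerivAt.comp x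
      (hasFDerivAt_ouPoint u x z)).congr_fderiv ?_
    ext v
    simp

lemma norm_smul_ouMean_le {φ : (Fin p → ℝ) → G} {C a u : ℝ} (hC : ∀ x, ‖φ x‖ ≤ C)
    (ha : |a| ≤ 1) (w : Fin p → ℝ) : ‖(a * exp (-u)) • ouMean φ u w‖ ≤ C * exp (-u) := by
  have h := norm_ouMean_le hC u w
  rw [norm_smul, norm_mul, norm_of_nonneg (exp_pos _).le, norm_eq_abs, mul_comm C]
  calc _ ≤ (1 * exp (-u)) * C := by gcongr
    _ = _ := by ring

lemma integrableOn_exp_smul_ouMean {φ : (Fin p → ℝ) → G} {C : ℝ} {a : ℝ → ℝ}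
    (hφ : Continuous φ) (hC : ∀ x, ‖φ x‖ ≤ C) (ha : Continuous a)
    (ha1 : ∀ u ∈ Set.Ioi (0 : ℝ), |a u| ≤ 1) (w : Fin p → ℝ) :
    IntegrableOn (fun u => (a u * exp (-u)) • ouMean φ u w) (Set.Ioi 0) := by
  have hcont : Continuous fun u => (a u * exp (-u)) • ouMean φ u w :=
    (by fun_prop : Continuous fun u => a u * exp (-u)).smul (continuous_ouMean hφ hC w)
  refine ((integrableOn_exp_neg_Ioi 0).const_mul C).mono' hcont.aestronglyMeasurable ?_
  refine (ae_restrict_iff' measurableSet_Ioi).2 (Eventually.of_forall fun u hu => ?_)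
  exact norm_smul_ouMean_le hC (ha1 u hu) w

lemma hasFDerivAt_integral_smul_ouMean {φ : (Fin p → ℝ) → G} {B C : ℝ} {a : ℝ → ℝ}
    (hφ : ContDiff ℝ 1 φ) (hB : ∀ x, ‖φ x‖ ≤ B) (hC : ∀ x, ‖fderiv ℝ φ x‖ ≤ C)
    (ha : Continuous a) (ha1 : ∀ u ∈ Set.Ioi (0 : ℝ), |a u| ≤ 1) (c : G)
    (hint : ∀ w, IntegrableOn (fun u => a u • (ouMean φ u w - c)) (Set.Ioi 0))
    (w : Fin p → ℝ) :
    HasFDerivAt (fun w => ∫ u in Set.Ioi 0, a u • (ouMean φ u w - c))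
      (∫ u in Set.Ioi 0, (a u * exp (-u)) • ouMean (fderiv ℝ φ) u w) w := by
  have hφ' := hφ.continuous_fderiv one_ne_zero
  refine hasFDerivAt_integral_of_dominated_of_fderiv_le
    (F' := fun w u => (a u * exp (-u)) • ouMean (fderiv ℝ φ) u w)
    (bound := fun u => C * exp (-u)) univ_mem
    (Eventually.of_forall fun w => (hint w).aestronglyMeasurable) (hint w)
    (integrableOn_exp_smul_ouMean hφ' hC ha ha1 w).aestronglyMeasurable ?_
    ((integrableOn_exp_neg_Ioi 0).const_mul C) ?_
  · refine (ae_restrict_iff' measurableSet_Ioi).2 (Eventually.of_forall fun u hu x _ => ?_)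
    exact norm_smul_ouMean_le hC (ha1 u hu) x
  · refine Eventually.of_forall fun u x _ => ?_
    rw [mul_smul]
    exact ((hasFDerivAt_ouMean hφ hB hC u x).sub_const c).const_smul (a u)

lemma abs_ou_scale_sub_one_le {u : ℝ} (hu : 0 ≤ u) : |√(1 - exp (-2 * u)) - 1| ≤ exp (-u) := by
  have he : exp (-2 * u) = exp (-u) * exp (-u) := by rw [← exp_add]; ring_nf
  have h1 : exp (-u) ≤ 1 := exp_le_one_iff.2 (by linarith)
  have h0 := exp_pos (-u)
  have hs := sqrt_nonneg (1 - exp (-2 * u))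
  have hss := mul_self_sqrt (show 0 ≤ 1 - exp (-2 * u) by nlinarith)
  rw [abs_le]
  constructor <;> nlinarith

lemma norm_ouMean_sub_le {φ : (Fin p → ℝ) → G} {B C : ℝ} (hφ : ContDiff ℝ 1 φ)
    (hB : ∀ x, ‖φ x‖ ≤ B) (hC : ∀ x, ‖fderiv ℝ φ x‖ ≤ C) {u : ℝ} (hu : 0 ≤ u)
    (w : Fin p → ℝ) :
    ‖ouMean φ u w - ∫ z, φ z ∂stdGaussianPi p‖
      ≤ (∫ z, C * (‖w‖ + ‖z‖) ∂stdGaussianPi p) * exp (-u) := by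
  have hb : Integrable (fun z : Fin p → ℝ => C * (‖w‖ + ‖z‖) * exp (-u)) (stdGaussianPi p) :=
    (((integrable_const _).add (integrable_norm_stdGaussianPi p)).const_mul C).mul_const _
  have hφi : Integrable φ (stdGaussianPi p) :=
    .of_bound hφ.continuous.aestronglyMeasurable B (Eventually.of_forall hB)
  unfold ouMean
  rw [← integral_sub (integrable_comp_ouPoint hφ.continuous hB u w) hφi, ← integral_mul_const]
  refine norm_integral_le_of_norm_le hb (Eventually.of_forall fun z => ?_)
  have hC0 : 0 ≤ C := (norm_nonneg _).trans (hC 0)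
  refine (convex_univ.norm_image_sub_le_of_norm_fderiv_le (𝕜 := ℝ)
    (fun x _ => hφ.differentiable one_ne_zero x) (fun x _ => hC x)
    (Set.mem_univ z) (Set.mem_univ (ouPoint u w z))).trans ?_
  rw [mul_assoc]
  gcongr
  have : ouPoint u w z - z = exp (-u) • w + (√(1 - exp (-2 * u)) - 1) • z := by
    unfold ouPoint
    module
  rw [this]
  refine (norm_add_le _ _).trans ?_
  rw [norm_smul, norm_smul, norm_of_nonneg (exp_pos _).le, norm_eq_abs, add_mul,
    mul_comm ‖w‖, mul_comm ‖z‖]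
  gcongr
  exact abs_ou_scale_sub_one_le hu

lemma hasDerivAt_ouPoint {u : ℝ} (hu : 0 < u) (w z : Fin p → ℝ) :
    HasDerivAt (fun u => ouPoint u w z)
      (-exp (-u) • w + (exp (-2 * u) / √(1 - exp (-2 * u))) • z) u := by
  have hpos : 0 < 1 - exp (-2 * u) := by
    have : exp (-2 * u) < 1 := exp_lt_one_iff.2 (by linarith)
    linarith
  have h1 : HasDerivAt (fun u : ℝ => exp (-u)) (-exp (-u)) u := by
    simpa using (hasDerivAt_neg u).exp
  have h2 : HasDerivAt (fun u : ℝ => √(1 - exp (-2 * u)))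
      (exp (-2 * u) / √(1 - exp (-2 * u))) u := by
    have h := ((((hasDerivAt_id' u).const_mul (-2)).exp).const_sub 1).sqrt hpos.ne'
    refine h.congr_deriv ?_
    have := (sqrt_pos.2 hpos).ne'
    field_simp
  exact (h1.smul_const w).add (h2.smul_const z)

lemma hasDerivAt_ouMean {φ : (Fin p → ℝ) → G} {B C : ℝ} (hφ : ContDiff ℝ 1 φ)
    (hB : ∀ x, ‖φ x‖ ≤ B) (hC : ∀ x, ‖fderiv ℝ φ x‖ ≤ C) {u : ℝ} (hu : 0 < u)
    (w : Fin p → ℝ) :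
    HasDerivAt (fun u => ouMean φ u w)
      (∫ z, fderiv ℝ φ (ouPoint u w z)
        (-exp (-u) • w + (exp (-2 * u) / √(1 - exp (-2 * u))) • z) ∂stdGaussianPi p) u := by
  have hφ' := hφ.continuous_fderiv one_ne_zero
  refine (hasDerivAt_integral_of_dominated_loc_of_deriv_le
    (F := fun u z => φ (ouPoint u w z))
    (F' := fun u z => fderiv ℝ φ (ouPoint u w z)
        (-exp (-u) • w + (exp (-2 * u) / √(1 - exp (-2 * u))) • z))
    (bound := fun z => C * (‖w‖ + 1 / √(1 - exp (-u)) * ‖z‖))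
    (Ioi_mem_nhds (half_lt_self hu))
    (Eventually.of_forall fun u =>
      (integrable_comp_ouPoint hφ.continuous hB u w).aestronglyMeasurable)
    (integrable_comp_ouPoint hφ.continuous hB u w)
    (((hφ'.comp (continuous_ouPoint_right u w)).clm_apply (by fun_prop)).aestronglyMeasurable)
    (Eventually.of_forall fun z x hx => ?_)
    (((integrable_const _).add ((integrable_norm_stdGaussianPi p).const_mul _)).const_mul C)
    (Eventually.of_forall fun z x hx => ?_)).2
  · have hx' : u / 2 < x := hx
    have hC0 : 0 ≤ C := (norm_nonneg _).trans (hC 0)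
    refine ((fderiv ℝ φ (ouPoint x w z)).le_opNorm _).trans ?_
    gcongr
    · exact hC _
    refine (norm_add_le _ _).trans ?_
    rw [norm_smul, norm_smul, norm_neg, norm_of_nonneg (exp_pos _).le,
      norm_of_nonneg (by positivity)]
    have h1 : exp (-x) ≤ 1 := exp_le_one_iff.2 (by linarith)
    have h2 : exp (-2 * x) ≤ exp (-u) := exp_le_exp.2 (by linarith)
    have h3 : exp (-u) < 1 := exp_lt_one_iff.2 (by linarith)
    have h4 : 0 < √(1 - exp (-u)) := sqrt_pos.2 (by linarith)
    refine add_le_add (mul_le_of_le_one_left (norm_nonneg _) h1) ?_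
    gcongr
    linarith
  · have hx' : u / 2 < x := hx
    exact (hφ.differentiable one_ne_zero _).hasFDerivAt.comp_hasDerivAt x
      (hasDerivAt_ouPoint (by linarith) w z)

lemma ouMean_apply [CompleteSpace G] {L : (Fin p → ℝ) → (Fin p → ℝ) →L[ℝ] G} {C : ℝ}
    (hL : Continuous L) (hC : ∀ x, ‖L x‖ ≤ C) (u : ℝ) (w v : Fin p → ℝ) :
    ouMean L u w v = ouMean (fun x => L x v) u w :=
  ContinuousLinearMap.integral_apply (integrable_comp_ouPoint hL hC u w) v

/-- Gaussian integration by parts along the Ornstein–Uhlenbeck semigroup. -/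
lemma integral_eval_mul_comp_ouPoint {f : (Fin p → ℝ) → ℝ} {B C : ℝ} (hf : ContDiff ℝ 1 f)
    (hB : ∀ x, ‖f x‖ ≤ B) (hC : ∀ x, ‖fderiv ℝ f x‖ ≤ C) (u : ℝ) (w : Fin p → ℝ) (i : Fin p) :
    ∫ z, z i * f (ouPoint u w z) ∂stdGaussianPi p
      = √(1 - exp (-2 * u)) * ouMean (fun x => fderiv ℝ f x (Pi.single i 1)) u w := by
  have hd : ∀ z, HasFDerivAt (fun z => f (ouPoint u w z))
      (√(1 - exp (-2 * u)) • fderiv ℝ f (ouPoint u w z)) z := fun z => by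
    have hp : HasFDerivAt (ouPoint u w)
        (√(1 - exp (-2 * u)) • ContinuousLinearMap.id ℝ (Fin p → ℝ)) z :=
      ((hasFDerivAt_id z).const_smul (√(1 - exp (-2 * u)))).const_add (exp (-u) • w)
    refine ((hf.differentiable one_ne_zero _).hasFDerivAt.comp z hp).congr_fderiv ?_
    ext v
    simp
  have hsm : ContDiff ℝ 1 fun z => f (ouPoint u w z) :=
    hf.comp (contDiff_const.add (contDiff_id.const_smul _))
  rw [integral_eval_mul_stdGaussianPi hsm (fun _ => hB _)
    (C' := √(1 - exp (-2 * u)) * C) (fun z => ?_) i]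
  · simp only [(hd _).fderiv, ouMean]
    exact integral_const_mul _ _
  · rw [(hd z).fderiv, norm_smul, norm_of_nonneg (sqrt_nonneg _)]
    gcongr
    exact hC _

lemma fderiv_fderiv_apply {h : (Fin p → ℝ) → ℝ} (hh : ContDiff ℝ 2 h) (x v w : Fin p → ℝ) :
    fderiv ℝ (fun y => fderiv ℝ h y v) x w = fderiv ℝ (fderiv ℝ h) x w v := by
  have hd : DifferentiableAt ℝ (fderiv ℝ h) x :=
    (hh.fderiv_right (m := 1) (by norm_num)).differentiable one_ne_zero x
  rw [(hd.hasFDerivAt.clm_apply (hasFDerivAt_const v x)).fderiv]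
  simp

/-- Along the Ornstein–Uhlenbeck semigroup, `∂ᵤ (T_u h) = Δ (T_u h) - w ⬝ ∇ (T_u h)`. -/
lemma hasDerivAt_ouMean_generator {h : (Fin p → ℝ) → ℝ} {C₀ C₁ C₂ : ℝ} (hh : ContDiff ℝ 2 h)
    (h0 : ∀ x, ‖h x‖ ≤ C₀) (h1 : ∀ x, ‖fderiv ℝ h x‖ ≤ C₁)
    (h2 : ∀ x, ‖fderiv ℝ (fderiv ℝ h) x‖ ≤ C₂) {u : ℝ} (hu : 0 < u) (w : Fin p → ℝ) :
    HasDerivAt (fun u => ouMean h u w)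
      (∑ i, ((exp (-u) * exp (-u)) • ouMean (fderiv ℝ (fderiv ℝ h)) u w)
          (Pi.single i 1) (Pi.single i 1)
        - ∑ i, w i * (exp (-u) • ouMean (fderiv ℝ h) u w) (Pi.single i 1)) u := by
  have hh1 : ContDiff ℝ 1 h := hh.of_le (by norm_num)
  have hD : ContDiff ℝ 1 (fderiv ℝ h) := hh.fderiv_right (by norm_num)
  have hDc := hD.continuous
  have hDDc := hD.continuous_fderiv one_ne_zero
  refine (hasDerivAt_ouMean hh1 h0 h1 hu w).congr_deriv ?_
  have hs : √(1 - exp (-2 * u)) ≠ 0 :=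
    (sqrt_pos.2 (sub_pos.2 (exp_lt_one_iff.2 (by linarith)))).ne'
  set s := √(1 - exp (-2 * u)) with hs_def
  have hb : ∀ i x, ‖fderiv ℝ h x (Pi.single i 1)‖ ≤ C₁ := fun i x =>
    ((fderiv ℝ h x).le_opNorm _).trans (by simpa [Pi.norm_single] using h1 x)
  have hcD : ∀ i, ContDiff ℝ 1 fun x => fderiv ℝ h x (Pi.single i 1) := fun i =>
    hD.clm_apply contDiff_const
  have hbD : ∀ i x, ‖fderiv ℝ (fun y => fderiv ℝ h y (Pi.single i 1)) x‖ ≤ C₂ := fun i x => by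
    have hC0 : 0 ≤ C₂ := (norm_nonneg (fderiv ℝ (fderiv ℝ h) 0)).trans (h2 0)
    refine ContinuousLinearMap.opNorm_le_bound _ hC0 fun v => ?_
    rw [fderiv_fderiv_apply hh]
    refine ((fderiv ℝ (fderiv ℝ h) x).le_opNorm₂ _ _).trans ?_
    simp only [Pi.norm_single, norm_one, mul_one]
    gcongr
    exact h2 x
  have hibp : ∀ i, ∫ z, z i * fderiv ℝ h (ouPoint u w z) (Pi.single i 1) ∂stdGaussianPi p
      = s * ouMean (fderiv ℝ (fderiv ℝ h)) u w (Pi.single i 1) (Pi.single i 1) := fun i => by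
    have hDDi : Continuous fun x => fderiv ℝ (fderiv ℝ h) x (Pi.single i 1) :=
      hDDc.clm_apply continuous_const
    rw [integral_eval_mul_comp_ouPoint (hcD i) (hb i) (hbD i), ouMean_apply hDDc h2,
      ouMean_apply hDDi (C := C₂) (fun x => ((fderiv ℝ (fderiv ℝ h) x).le_opNorm _).trans
        (by simpa [Pi.norm_single] using h2 x))]
    simp only [fderiv_fderiv_apply hh, hs_def]
  have hi1 : ∀ i, Integrable (fun z => w i * fderiv ℝ h (ouPoint u w z) (Pi.single i 1))
      (stdGaussianPi p) := fun i =>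
    (integrable_comp_ouPoint (hcD i).continuous (hb i) u w).const_mul _
  have hi2 : ∀ i, Integrable (fun z => z i * fderiv ℝ h (ouPoint u w z) (Pi.single i 1))
      (stdGaussianPi p) := fun i =>
    (integrable_comp_eval (μ := fun _ : Fin p => gaussianReal 0 1) (i := i)
      integrable_id_gaussianReal).mul_bdd
      ((hcD i).continuous.comp (continuous_ouPoint_right u w)).aestronglyMeasurable
      (Eventually.of_forall fun _ => hb i _)
  have hsplit : ∀ z, fderiv ℝ h (ouPoint u w z) (-exp (-u) • w + (exp (-2 * u) / s) • z)
      = (exp (-2 * u) / s) * ∑ i, z i * fderiv ℝ h (ouPoint u w z) (Pi.single i 1)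
        - exp (-u) * ∑ i, w i * fderiv ℝ h (ouPoint u w z) (Pi.single i 1) := fun z => by
    rw [map_add, map_smul, map_smul, clm_apply_eq_sum _ w, clm_apply_eq_sum _ z]
    simp only [smul_eq_mul]
    ring
  simp only [hsplit]
  rw [integral_sub ((integrable_finsetSum _ fun i _ => hi2 i).const_mul _)
    ((integrable_finsetSum _ fun i _ => hi1 i).const_mul _), integral_const_mul,
    integral_const_mul, integral_finsetSum _ fun i _ => hi2 i,
    integral_finsetSum _ fun i _ => hi1 i]
  simp only [hibp, integral_const_mul]
  have he : exp (-2 * u) = exp (-u) * exp (-u) := by rw [← exp_add]; ring_nf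
  rw [he, Finset.mul_sum, Finset.mul_sum]
  congr 1 <;> refine Finset.sum_congr rfl fun i _ => ?_
  · simp only [smul_apply, smul_eq_mul]
    field_simp
  · rw [smul_apply, ouMean_apply hDc h1, smul_eq_mul]
    simp only [ouMean]
    ring

end OrnsteinUhlenbeck

/-- **The Stein equation solution** (Barbour, Götze; Goldstein–Rinott, Lemma 3.1, first
part). For bounded `h : ℝᵖ → ℝ` with bounded mixed partial derivatives up to order 3,
the function `g(w) = -∫₀^∞ [(T_u h)(w) - Φh] du` is well defined (the integrand is
integrable on `(0,∞)`) and solves `tr D²g(w) - w ⋅ ∇g(w) = h(w) - Φh` for all `w`. -/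
theorem stein_equation_solution
    {p : ℕ} (h : (Fin p → ℝ) → ℝ)
    (hhbdd : ∃ C, ∀ x, |h x| ≤ C) (hh : ContDiff ℝ 3 h)
    (hDbdd : ∀ k : ℕ, 1 ≤ k → k ≤ 3 → ∃ C, ∀ (idx : Fin k → Fin p) (w : Fin p → ℝ),
      |mixedPartial k h idx w| ≤ C)
    (Φh : ℝ) (hΦh : Φh = ∫ z, h z ∂(stdGaussianPi p))
    (g : (Fin p → ℝ) → ℝ)
    (hg : g = fun w => -∫ u in Set.Ioi (0 : ℝ), (ouSemigroup u h w - Φh)) :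
    (∀ w, IntegrableOn (fun u => ouSemigroup u h w - Φh) (Set.Ioi 0)) ∧
    (∀ w, (∑ i, mixedPartial 2 g (fun _ => i) w)
        - ∑ i, w i * mixedPartial 1 g (fun _ => i) w = h w - Φh) := by
  obtain ⟨C₀, h0⟩ := hhbdd
  obtain ⟨C₁, hC₁⟩ := hDbdd 1 le_rfl (by norm_num)
  obtain ⟨C₂, hC₂⟩ := hDbdd 2 (by norm_num) (by norm_num)
  have hh2 : ContDiff ℝ 2 h := hh.of_le (by norm_num)
  have hh1 : ContDiff ℝ 1 h := hh.of_le (by norm_num)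
  have hD : ContDiff ℝ 1 (fderiv ℝ h) := hh2.fderiv_right (by norm_num)
  have hDDc := hD.continuous_fderiv one_ne_zero
  have h1 : ∀ x, ‖fderiv ℝ h x‖ ≤ p * |C₁| := fun x =>
    opNorm_le_of_norm_single_le fun i => by
      simpa [mixedPartial] using hC₁ (fun _ => i) x
  have h2 : ∀ x, ‖fderiv ℝ (fderiv ℝ h) x‖ ≤ p * |(p * |C₂| : ℝ)| := fun x =>
    opNorm_le_of_norm_single_le fun i => opNorm_le_of_norm_single_le fun j => by
      simpa [mixedPartial, iteratedFDeriv_two_apply] using hC₂ ![i, j] x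
  simp only [ouSemigroup_eq_ouMean] at hg ⊢
  have hdecay : ∀ w, ∀ u, 0 ≤ u → ‖ouMean h u w - Φh‖
      ≤ (∫ z, p * |C₁| * (‖w‖ + ‖z‖) ∂stdGaussianPi p) * exp (-u) := fun w u hu => by
    rw [hΦh]
    exact norm_ouMean_sub_le hh1 h0 h1 hu w
  have hcont := continuous_ouMean hh.continuous h0
  have hint : ∀ w, IntegrableOn (fun u => ouMean h u w - Φh) (Set.Ioi 0) := fun w =>
    ((integrableOn_exp_neg_Ioi 0).const_mul _).mono'
      ((hcont w).sub continuous_const).aestronglyMeasurable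
      ((ae_restrict_iff' measurableSet_Ioi).2
        (Eventually.of_forall fun u hu => hdecay w u (Set.mem_Ioi.1 hu).le))
  refine ⟨hint, fun w => ?_⟩
  have hexp : ∀ u ∈ Set.Ioi (0 : ℝ), |exp (-u)| ≤ 1 := fun u hu => by
    rw [abs_of_pos (exp_pos _)]
    exact exp_le_one_iff.2 (by linarith [Set.mem_Ioi.1 hu])
  have hI1 : ∀ w, IntegrableOn (fun u => exp (-u) • ouMean (fderiv ℝ h) u w) (Set.Ioi 0) :=
    fun w => by
      simpa using integrableOn_exp_smul_ouMean (a := fun _ => 1) hD.continuous h1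
        continuous_const (by simp) w
  have hI2 := integrableOn_exp_smul_ouMean (a := fun u => exp (-u)) hDDc h2 (by fun_prop) hexp
  have hg1 : fderiv ℝ g = fun w => -∫ u in Set.Ioi 0, exp (-u) • ouMean (fderiv ℝ h) u w := by
    ext1 w
    have := hasFDerivAt_integral_smul_ouMean (a := fun _ => 1) hh1 h0 h1 continuous_const
      (by simp) Φh (by simpa using hint) w
    simp only [one_smul, one_mul] at this
    rw [hg]
    exact this.neg.fderiv
  have hg2 : fderiv ℝ (fderiv ℝ g) w = -∫ u in Set.Ioi 0,
      (exp (-u) * exp (-u)) • ouMean (fderiv ℝ (fderiv ℝ h)) u w := by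
    have := hasFDerivAt_integral_smul_ouMean (a := fun u => exp (-u)) hD h1 h2 (by fun_prop)
      hexp 0 (by simpa using hI1) w
    simp only [sub_zero] at this
    rw [hg1]
    exact this.neg.fderiv
  have hlim : Tendsto (fun u => ouMean h u w) atTop (𝓝 Φh) := by
    rw [tendsto_iff_norm_sub_tendsto_zero]
    refine squeeze_zero' (Eventually.of_forall fun _ => norm_nonneg _)
      ((eventually_ge_atTop 0).mono fun u hu => hdecay w u hu) ?_
    simpa using (tendsto_exp_neg_atTop_nhds_zero).const_mul
      (∫ z, p * |C₁| * (‖w‖ + ‖z‖) ∂stdGaussianPi p)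
  have hI2i : ∀ i : Fin p, Integrable (fun u => ((exp (-u) * exp (-u)) •
      ouMean (fderiv ℝ (fderiv ℝ h)) u w) (Pi.single i 1) (Pi.single i 1))
      (volume.restrict (Set.Ioi 0)) := fun i =>
    ((hI2 w).apply_continuousLinearMap _).apply_continuousLinearMap _
  have hI1i : ∀ i : Fin p, Integrable (fun u => w i * (exp (-u) •
      ouMean (fderiv ℝ h) u w) (Pi.single i 1)) (volume.restrict (Set.Ioi 0)) := fun i =>
    ((hI1 w).apply_continuousLinearMap _).const_mul _
  have hFTC := integral_Ioi_of_hasDerivAt_of_tendsto (hcont w).continuousWithinAt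
    (fun u hu => hasDerivAt_ouMean_generator hh2 h0 h1 h2 (Set.mem_Ioi.1 hu) w)
    ((integrable_finsetSum _ fun i _ => hI2i i).sub (integrable_finsetSum _ fun i _ => hI1i i))
    hlim
  rw [integral_sub (integrable_finsetSum _ fun i _ => hI2i i)
    (integrable_finsetSum _ fun i _ => hI1i i), integral_finsetSum _ fun i _ => hI2i i,
    integral_finsetSum _ fun i _ => hI1i i] at hFTC
  have hzero : ouMean h 0 w = h w := by simp [ouMean, ouPoint]
  have hm2 : ∀ i : Fin p, mixedPartial 2 g (fun _ => i) w = -∫ u in Set.Ioi 0,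
      ((exp (-u) * exp (-u)) • ouMean (fderiv ℝ (fderiv ℝ h)) u w)
        (Pi.single i 1) (Pi.single i 1) := fun i => by
    rw [mixedPartial, iteratedFDeriv_two_apply, hg2, neg_apply,
      neg_apply, ContinuousLinearMap.integral_apply (hI2 w),
      ContinuousLinearMap.integral_apply ((hI2 w).apply_continuousLinearMap _)]
  have hm1 : ∀ i : Fin p, w i * mixedPartial 1 g (fun _ => i) w = -∫ u in Set.Ioi 0,
      w i * (exp (-u) • ouMean (fderiv ℝ h) u w) (Pi.single i 1) := fun i => by
    rw [mixedPartial, iteratedFDeriv_one_apply, hg1, neg_apply,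
      ContinuousLinearMap.integral_apply (hI1 w), integral_const_mul, mul_neg]
  simp only [hm1, hm2, Finset.sum_neg_distrib]
  rw [hzero] at hFTC
  linarith
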